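/- arXiv:math/0404368 — 4 statements merged into one kernel-verified Lean document; each statement's English description precedes it below -/
import Mathlib

section
/- There exists ρ_0 > 0 with the following property (expansiveness along random orbits): for every sequence (v_j)_{j≥1} of points of ℝ^n and all x, y ∈ 𝕋^n, if dist(x, y) ≤ ρ_0 and dist(f_{v_j} ∘ ⋯ ∘ f_{v_1}(x), f_{v_j} ∘ ⋯ ∘ f_{v_1}(y)) ≤ ρ_0 for every j ≥ 1, then x = y. -/
open MeasureTheory Set Filter Topology

noncomputable section

/-- The `n`-torus `𝕋ⁿ = ℝⁿ/ℤⁿ`. -/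
abbrev Torus (n : ℕ) : Type := Fin n → AddCircle (1 : ℝ)

/-- The canonical projection `ℝⁿ → 𝕋ⁿ`. -/
def tproj (n : ℕ) (x : Fin n → ℝ) : Torus n := fun i => (x i : AddCircle (1 : ℝ))

/-- The set of points of `ℝⁿ` where the inverse of the derivative of the lift `F`
has (operator) norm one. Its projection to the torus is the set `K`. -/
def KsetF (n : ℕ) (F : (Fin n → ℝ) → Fin n → ℝ) : Set (Fin n → ℝ) :=
  {x | ‖Ring.inverse (fderiv ℝ F x)‖ = 1}

/-- The hypotheses on `f : 𝕋ⁿ → 𝕋ⁿ`: `f` is a `C^{1+α}` local diffeomorphism with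
lift `F`, with `‖Df(x)⁻¹‖ ≤ 1` everywhere, and `K = {‖Df(x)⁻¹‖ = 1}` finite. -/
structure TorusHyp (n : ℕ) (α : ℝ) (f : Torus n → Torus n)
    (F : (Fin n → ℝ) → Fin n → ℝ) : Prop where
  hn : 1 ≤ n
  hα0 : 0 < α
  hα1 : α ≤ 1
  hlift : ∀ x, f (tproj n x) = tproj n (F x)
  hdiff : Differentiable ℝ F
  hHolder : ∃ C : ℝ, ∀ x y, ‖fderiv ℝ F x - fderiv ℝ F y‖ ≤ C * ‖x - y‖ ^ α
  hunit : ∀ x, IsUnit (fderiv ℝ F x)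
  hinvnorm : ∀ x, ‖Ring.inverse (fderiv ℝ F x)‖ ≤ 1
  hKfin : (tproj n '' KsetF n F).Finite

/-- The basin of an invariant measure. -/
def basin {n : ℕ} (f : Torus n → Torus n) (μ : Measure (Torus n)) : Set (Torus n) :=
  {x | ∀ φ : C(Torus n, ℝ),
    Tendsto (fun N : ℕ => (N : ℝ)⁻¹ * ∑ j ∈ Finset.range N, φ (f^[j] x)) atTop
      (𝓝 (∫ y, φ y ∂μ))}

/-- The (closed) support of a measure on a topological space. -/
def mSupport {Y : Type*} [TopologicalSpace Y] [MeasurableSpace Y] (θ : Measure Y) : Set Y :=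
  {t | ∀ U ∈ 𝓝 t, θ U ≠ 0}

/-- `μ` is a stationary measure for the random system given by the family `g`
of maps of the torus and the noise distribution `θ`. -/
def IsStationaryT {n : ℕ} (g : (Fin n → ℝ) → Torus n → Torus n)
    (θ : Measure (Fin n → ℝ)) (μ : Measure (Torus n)) : Prop :=
  ∀ φ : C(Torus n, ℝ), ∫ x, ∫ v, φ (g v x) ∂θ ∂μ = ∫ x, φ x ∂μ


/-- The random orbit maps `f_{v_j} ∘ ⋯ ∘ f_{v_1}` for the additive perturbations
`f_v = f + v (mod ℤⁿ)`. -/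
noncomputable def rIter {n : ℕ} (f : Torus n → Torus n) (v : ℕ → Fin n → ℝ) :
    ℕ → Torus n → Torus n
  | 0 => id
  | j + 1 => fun x => f (rIter f v j x) + tproj n (v (j + 1))

/-- A strict mean value inequality: if the speed of a curve on `[0, 1]` is bounded by `C`, and is
less than `C` at some interior time, then the end points are at distance less than `C`. -/
theorem norm_sub_lt_of_norm_deriv_lt {E : Type*} [NormedAddCommGroup E] [NormedSpace ℝ E]
    {γ γ' : ℝ → E} {C : ℝ} (hγ : ∀ t ∈ Icc (0 : ℝ) 1, HasDerivAt γ (γ' t) t)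
    (hC : ∀ t ∈ Icc (0 : ℝ) 1, ‖γ' t‖ ≤ C) {t₀ : ℝ} (ht₀ : t₀ ∈ Ioo (0 : ℝ) 1)
    (hlt : ‖γ' t₀‖ < C) : ‖γ 1 - γ 0‖ < C := by
  have hmv : ∀ a ∈ Icc (0 : ℝ) 1, ∀ b ∈ Icc (0 : ℝ) 1, ‖γ b - γ a‖ ≤ C * ‖b - a‖ :=
    fun a ha b hb => Convex.norm_image_sub_le_of_norm_hasDerivWithin_le
      (fun t ht => (hγ t ht).hasDerivWithinAt) hC (convex_Icc 0 1) ha hb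
  have hslope := (hγ t₀ (Ioo_subset_Icc_self ht₀)).hasDerivWithinAt.limsup_norm_slope_le
    (s := Ioi t₀) hlt
  obtain ⟨t, ht, htI⟩ := (hslope.and (Ioo_mem_nhdsGT ht₀.2)).exists
  have hpos : 0 < ‖t - t₀‖ := norm_pos_iff.2 (sub_ne_zero.2 htI.1.ne')
  have h₁ : ‖γ t - γ t₀‖ < C * ‖t - t₀‖ := by
    rwa [inv_mul_lt_iff₀ hpos, mul_comm] at ht
  have ht01 : t ∈ Icc (0 : ℝ) 1 := ⟨(ht₀.1.trans htI.1).le, htI.2.le⟩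
  have h₀ := hmv 0 (by simp) t₀ (Ioo_subset_Icc_self ht₀)
  have h₂ := hmv t ht01 1 (by simp)
  rw [Real.norm_of_nonneg (by linarith [htI.1])] at h₁
  rw [Real.norm_of_nonneg (by linarith [ht₀.1])] at h₀
  rw [Real.norm_of_nonneg (by linarith [ht01.2])] at h₂
  calc ‖γ 1 - γ 0‖ = ‖(γ 1 - γ t) + (γ t - γ t₀) + (γ t₀ - γ 0)‖ := by congr 1; abel
    _ ≤ ‖γ 1 - γ t‖ + ‖γ t - γ t₀‖ + ‖γ t₀ - γ 0‖ := norm_add₃_le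
    _ < C := by linarith

/-- A map whose derivative is invertible with inverse of norm at most one, with equality only at
finitely many points of a ball on which the derivative varies little, strictly increases the
distance from the centre of the ball to nearby points. -/
theorem norm_sub_lt_norm_image_sub {E : Type*} [NormedAddCommGroup E] [NormedSpace ℝ E]
    [CompleteSpace E] {F : E → E} (hF : Differentiable ℝ F)
    (hunit : ∀ z, IsUnit (fderiv ℝ F z)) (hinv : ∀ z, ‖Ring.inverse (fderiv ℝ F z)‖ ≤ 1)
    {x y : E} {r : ℝ} (hr : 0 < r)
    (hclose : ∀ z ∈ Metric.ball x r, ‖fderiv ℝ F z - fderiv ℝ F x‖ ≤ 1 / 2)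
    (hfin : ({z | ‖Ring.inverse (fderiv ℝ F z)‖ = 1} ∩ Metric.ball x r).Finite)
    (hy : y ∈ Metric.ball x r) (hxy : y ≠ x) (hFxy : ‖F y - F x‖ ≤ r / 4) :
    ‖y - x‖ < ‖F y - F x‖ := by
  have : Nontrivial E := ⟨⟨y, x, hxy⟩⟩
  choose u hu using hunit
  let A : E → (E ≃L[ℝ] E) := fun z => ContinuousLinearEquiv.ofUnit (u z)
  have hA : ∀ z, (A z : E →L[ℝ] E) = fderiv ℝ F z := fun z => by
    rw [← hu z]; rfl
  have hAsymm : ∀ z, ((A z).symm : E →L[ℝ] E) = Ring.inverse (fderiv ℝ F z) := fun z => by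
    rw [← hu z, Ring.inverse_unit]; rfl
  have happ : ApproximatesLinearOn F (A x : E →L[ℝ] E) (Metric.ball x r) (1 / 2 : NNReal) := by
    intro a ha b hb
    rw [hA]
    have := Convex.norm_image_sub_le_of_norm_hasFDerivWithin_le'
      (fun z _ => (hF z).hasFDerivAt.hasFDerivWithinAt) hclose (convex_ball x r) hb ha
    simpa using this
  have hN0 : 0 < ‖((A x).symm : E →L[ℝ] E)‖ := (A x).norm_symm_pos
  have hN1 : ‖((A x).symm : E →L[ℝ] E)‖ ≤ 1 := by rw [hAsymm]; exact hinv x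
  have hN : 1 ≤ ‖((A x).symm : E →L[ℝ] E)‖⁻¹ := (one_le_inv₀ hN0).2 hN1
  have hc : Subsingleton E ∨ (1 / 2 : NNReal) < ‖((A x).symm : E →L[ℝ] E)‖₊⁻¹ := by
    right
    rw [← NNReal.coe_lt_coe]
    push_cast
    linarith
  have htarget := happ.closedBall_subset_target hc Metric.isOpen_ball (by positivity : 0 ≤ r / 2)
    (Metric.closedBall_subset_ball (by linarith))
  let φ := happ.toOpenPartialHomeomorph F (Metric.ball x r) hc Metric.isOpen_ball
  have hball : Metric.closedBall (F x) (r / 4) ⊆ φ.target := by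
    refine (Metric.closedBall_subset_closedBall ?_).trans htarget
    push_cast
    nlinarith
  let ℓ : ℝ → E := fun t => F x + t • (F y - F x)
  have hℓ : ∀ t ∈ Icc (0 : ℝ) 1, ℓ t ∈ φ.target := by
    intro t ht
    apply hball
    rw [mem_closedBall_iff_norm, add_sub_cancel_left, norm_smul, Real.norm_of_nonneg ht.1]
    nlinarith [ht.2, norm_nonneg (F y - F x)]
  have hℓ' : ∀ t, HasDerivAt ℓ (F y - F x) t := fun t => by
    have h := ((hasDerivAt_id t).smul_const (F y - F x)).const_add (F x)
    rwa [one_smul] at h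
  have hder : ∀ t ∈ Icc (0 : ℝ) 1, HasDerivAt (fun t => φ.symm (ℓ t))
      (Ring.inverse (fderiv ℝ F (φ.symm (ℓ t))) (F y - F x)) t := by
    intro t ht
    rw [← hAsymm]
    refine (φ.hasFDerivAt_symm (hℓ t ht) ?_).comp_hasDerivAt t (hℓ' t)
    rw [hA]
    exact (hF _).hasFDerivAt
  have hφx : φ.symm (ℓ 0) = x := by
    have : ℓ 0 = φ x := by simp [ℓ, φ]
    rw [this]
    exact φ.left_inv (Metric.mem_ball_self hr)
  have hφy : φ.symm (ℓ 1) = y := by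
    have : ℓ 1 = φ y := by simp [ℓ, φ]
    rw [this]
    exact φ.left_inv hy
  have hne : F y - F x ≠ 0 := by
    intro h
    apply hxy
    rw [← hφx, ← hφy]
    simp [ℓ, h]
  have hpos : 0 < ‖F y - F x‖ := norm_pos_iff.2 hne
  have hinj : InjOn (fun t => φ.symm (ℓ t)) (Ioo (0 : ℝ) 1) := by
    intro s hs t ht hst
    have h := φ.symm.injOn (hℓ s (Ioo_subset_Icc_self hs)) (hℓ t (Ioo_subset_Icc_self ht)) hst
    exact smul_left_injective ℝ hne (add_left_cancel h)
  obtain ⟨t₀, ht₀, hlt⟩ : ∃ t₀ ∈ Ioo (0 : ℝ) 1,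
      ‖Ring.inverse (fderiv ℝ F (φ.symm (ℓ t₀)))‖ < 1 := by
    by_contra! hcon
    refine (Ioo_infinite (zero_lt_one' ℝ)) (Finite.of_finite_image (hfin.subset ?_) hinj)
    rintro _ ⟨t, ht, rfl⟩
    exact ⟨le_antisymm (hinv _) (hcon t ht), φ.map_target (hℓ t (Ioo_subset_Icc_self ht))⟩
  have := norm_sub_lt_of_norm_deriv_lt (C := ‖F y - F x‖) hder
    (fun t _ => ContinuousLinearMap.le_of_opNorm_le _ (hinv _) _ |>.trans_eq (one_mul _)) ht₀
    ((ContinuousLinearMap.le_opNorm _ _).trans_lt (by nlinarith))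
  rwa [hφx, hφy] at this

theorem tproj_sub (n : ℕ) (x y : Fin n → ℝ) : tproj n x - tproj n y = tproj n (x - y) := rfl

theorem norm_tproj_le (n : ℕ) (x : Fin n → ℝ) : ‖tproj n x‖ ≤ ‖x‖ := by
  refine (pi_norm_le_iff_of_nonneg (norm_nonneg x)).2 fun i => ?_
  refine le_trans ?_ (norm_le_pi_norm x i)
  exact QuotientAddGroup.norm_mk_le_norm

theorem norm_tproj_of_norm_le_half (n : ℕ) {x : Fin n → ℝ} (hx : ‖x‖ ≤ 1 / 2) :
    ‖tproj n x‖ = ‖x‖ := by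
  refine le_antisymm (norm_tproj_le n x) ?_
  refine (pi_norm_le_iff_of_nonneg (norm_nonneg _)).2 fun i => ?_
  refine le_trans (le_of_eq ?_) (norm_le_pi_norm (tproj n x) i)
  refine ((AddCircle.norm_coe_eq_abs_iff (1 : ℝ) one_ne_zero).2 ?_).symm
  simpa using (norm_le_pi_norm x i).trans hx

theorem tproj_injOn_ball (n : ℕ) (x : Fin n → ℝ) :
    InjOn (tproj n) (Metric.ball x (1 / 4)) := by
  intro a ha b hb hab
  have hle : ‖a - b‖ ≤ 1 / 2 := by
    rw [← dist_eq_norm]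
    have := dist_triangle_right a b x
    have := Metric.mem_ball.1 ha
    have := Metric.mem_ball.1 hb
    linarith
  have h := norm_tproj_of_norm_le_half n hle
  rw [← tproj_sub, hab, sub_self, norm_zero] at h
  exact sub_eq_zero.1 (norm_eq_zero.1 h.symm)

theorem tproj_add_intCast (n : ℕ) (x : Fin n → ℝ) (k : Fin n → ℤ) :
    tproj n (x + fun i => (k i : ℝ)) = tproj n x := by
  funext i
  simp only [tproj, Pi.add_apply]
  rw [AddCircle.coe_add, add_eq_left, AddCircle.coe_eq_zero_iff]
  exact ⟨k i, by simp⟩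

/-- Two points of the torus have lifts realizing their distance. -/
theorem exists_lift_dist_eq (n : ℕ) (x y : Torus n) :
    ∃ a b : Fin n → ℝ, tproj n a = x ∧ tproj n b = y ∧ ‖b - a‖ = dist y x := by
  choose a ha using fun i => QuotientAddGroup.mk_surjective (x i)
  choose b hb using fun i => QuotientAddGroup.mk_surjective (y i)
  have ha : tproj n a = x := funext ha
  have hb : tproj n b = y := funext hb
  have ha' : tproj n (a + fun i => (round (b i - a i) : ℝ)) = x := by
    rw [tproj_add_intCast n a fun i => round (b i - a i), ha]
  refine ⟨a + fun i => (round (b i - a i) : ℝ), b, ha', hb, ?_⟩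
  rw [dist_eq_norm, ← hb, ← ha', tproj_sub]
  refine (norm_tproj_of_norm_le_half n ?_).symm
  refine (pi_norm_le_iff_of_nonneg (by norm_num)).2 fun i => ?_
  have := abs_sub_round (b i - a i)
  simp only [Pi.sub_apply, Pi.add_apply, Real.norm_eq_abs]
  rwa [← sub_sub]

/-- The derivative of a lift of a torus map is `ℤⁿ`-periodic. -/
theorem TorusHyp.fderiv_add_intCast {n : ℕ} {α : ℝ} {f : Torus n → Torus n}
    {F : (Fin n → ℝ) → Fin n → ℝ} (hyp : TorusHyp n α f F) (x : Fin n → ℝ) (k : Fin n → ℤ) :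
    fderiv ℝ F (x + fun i => (k i : ℝ)) = fderiv ℝ F x := by
  set κ : Fin n → ℝ := fun i => (k i : ℝ)
  let h : (Fin n → ℝ) → Fin n → ℝ := fun z => F (z + κ) - F z
  have hproj : ∀ z, tproj n (h z) = 0 := fun z => by
    rw [← tproj_sub, ← hyp.hlift, ← hyp.hlift, tproj_add_intCast, sub_self]
  have hdiff : Differentiable ℝ h :=
    (hyp.hdiff.comp (differentiable_id.add_const κ)).sub hyp.hdiff
  have hconst : h =ᶠ[𝓝 x] fun _ => h x := by
    filter_upwards [hdiff.continuous.continuousAt (Metric.ball_mem_nhds (h x) (by norm_num :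
      (0 : ℝ) < 1 / 4))] with z hz
    exact tproj_injOn_ball n (h x) hz (Metric.mem_ball_self (by norm_num))
      ((hproj z).trans (hproj x).symm)
  have hzero : fderiv ℝ h x = 0 := by
    rw [hconst.fderiv_eq]
    simp
  have hsub : fderiv ℝ h x = fderiv ℝ F (x + κ) - fderiv ℝ F x := by
    have h₁ : HasFDerivAt (fun z => F (z + κ)) (fderiv ℝ F (x + κ)) x := by
      rw [hasFDerivAt_comp_add_right]
      exact (hyp.hdiff _).hasFDerivAt
    exact (h₁.sub (hyp.hdiff x).hasFDerivAt).fderiv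
  rw [hsub] at hzero
  exact sub_eq_zero.1 hzero

theorem TorusHyp.exists_norm_fderiv_le {n : ℕ} {α : ℝ} {f : Torus n → Torus n}
    {F : (Fin n → ℝ) → Fin n → ℝ} (hyp : TorusHyp n α f F) :
    ∃ L : ℝ, 1 ≤ L ∧ ∀ x, ‖fderiv ℝ F x‖ ≤ L := by
  obtain ⟨C, hC⟩ := hyp.hHolder
  refine ⟨max 1 (‖fderiv ℝ F 0‖ + |C|), le_max_left _ _, fun x => le_max_of_le_right ?_⟩
  have hper := hyp.fderiv_add_intCast (fun i => Int.fract (x i)) fun i => ⌊x i⌋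
  have hx : ((fun i => Int.fract (x i)) + fun i => (⌊x i⌋ : ℝ)) = x :=
    funext fun i => Int.fract_add_floor (x i)
  rw [hx] at hper
  rw [hper]
  have hfract : ‖fun i => Int.fract (x i)‖ ≤ 1 :=
    (pi_norm_le_iff_of_nonneg zero_le_one).2 fun i => by
      rw [Real.norm_of_nonneg (Int.fract_nonneg _)]
      exact (Int.fract_lt_one _).le
  have h₁ := hC (fun i => Int.fract (x i)) 0
  rw [sub_zero] at h₁
  have h₂ : ‖fun i => Int.fract (x i)‖ ^ α ≤ 1 :=
    Real.rpow_le_one (norm_nonneg _) hfract hyp.hα0.le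
  have h₃ : C * ‖fun i => Int.fract (x i)‖ ^ α ≤ |C| :=
    (mul_le_mul_of_nonneg_right (le_abs_self C) (by positivity)).trans
      (mul_le_of_le_one_right (abs_nonneg C) h₂)
  have h₄ := norm_le_norm_add_norm_sub' (fderiv ℝ F fun i => Int.fract (x i)) (fderiv ℝ F 0)
  linarith

theorem TorusHyp.exists_fderiv_sub_le_half {n : ℕ} {α : ℝ} {f : Torus n → Torus n}
    {F : (Fin n → ℝ) → Fin n → ℝ} (hyp : TorusHyp n α f F) :
    ∃ r : ℝ, 0 < r ∧ r ≤ 1 / 4 ∧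
      ∀ x, ∀ z ∈ Metric.ball x r, ‖fderiv ℝ F z - fderiv ℝ F x‖ ≤ 1 / 2 := by
  obtain ⟨C, hC⟩ := hyp.hHolder
  have hlim : Tendsto (fun s : ℝ => |C| * s ^ α) (𝓝[>] 0) (𝓝 0) := by
    have h : ContinuousAt (fun s : ℝ => |C| * s ^ α) 0 :=
      continuousAt_const.mul (Real.continuousAt_rpow_const 0 α (Or.inr hyp.hα0.le))
    have h' := h.tendsto
    simp only [Real.zero_rpow hyp.hα0.ne', mul_zero] at h'
    exact h'.mono_left nhdsWithin_le_nhds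
  obtain ⟨r, hr, hr'⟩ := ((hlim.eventually (eventually_lt_nhds (by norm_num :
    (0 : ℝ) < 1 / 2))).and (Ioo_mem_nhdsGT (by norm_num : (0 : ℝ) < 1 / 4))).exists
  refine ⟨r, hr'.1, hr'.2.le, fun x z hz => ?_⟩
  have hz : ‖z - x‖ ≤ r := (mem_ball_iff_norm.1 hz).le
  calc ‖fderiv ℝ F z - fderiv ℝ F x‖ ≤ C * ‖z - x‖ ^ α := hC z x
    _ ≤ |C| * r ^ α := mul_le_mul (le_abs_self C)
        (Real.rpow_le_rpow (norm_nonneg _) hz hyp.hα0.le) (by positivity) (abs_nonneg C)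
    _ ≤ 1 / 2 := hr.le

theorem dist_tproj_le_of_norm_fderiv_le {n : ℕ} {f : Torus n → Torus n}
    {F : (Fin n → ℝ) → Fin n → ℝ} (hlift : ∀ x, f (tproj n x) = tproj n (F x))
    (hdiff : Differentiable ℝ F) {L : ℝ} (hL : ∀ x, ‖fderiv ℝ F x‖ ≤ L) (x y : Torus n) :
    dist (f x) (f y) ≤ L * dist x y := by
  obtain ⟨a, b, rfl, rfl, hab⟩ := exists_lift_dist_eq n y x
  rw [hlift, hlift, dist_eq_norm, tproj_sub, ← hab]
  exact (norm_tproj_le n _).trans (Convex.norm_image_sub_le_of_norm_fderiv_le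
    (fun z _ => hdiff z) (fun z _ => hL z) convex_univ (mem_univ a) (mem_univ b))

/-- The torus map strictly increases the distance between distinct nearby points. -/
theorem TorusHyp.exists_dist_lt_dist_image {n : ℕ} {α : ℝ} {f : Torus n → Torus n}
    {F : (Fin n → ℝ) → Fin n → ℝ} (hyp : TorusHyp n α f F) :
    ∃ ρ₀ > (0 : ℝ), ∀ x y : Torus n, x ≠ y → dist x y ≤ ρ₀ → dist x y < dist (f x) (f y) := by
  obtain ⟨L, hL1, hL⟩ := hyp.exists_norm_fderiv_le
  obtain ⟨r, hr0, hr4, hr⟩ := hyp.exists_fderiv_sub_le_half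
  refine ⟨r / (4 * L), by positivity, fun x y hxy hdist => ?_⟩
  obtain ⟨a, b, rfl, rfl, hab⟩ := exists_lift_dist_eq n y x
  rw [← hab, le_div_iff₀ (by positivity)] at hdist
  have hF : ‖F b - F a‖ ≤ L * ‖b - a‖ := Convex.norm_image_sub_le_of_norm_fderiv_le
    (fun z _ => hyp.hdiff z) (fun z _ => hL z) convex_univ (mem_univ a) (mem_univ b)
  have hF4 : ‖F b - F a‖ ≤ r / 4 := by linarith
  have hb : b ∈ Metric.ball a r := by
    rw [mem_ball_iff_norm]
    nlinarith [norm_nonneg (b - a)]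
  have hfin : (KsetF n F ∩ Metric.ball a r).Finite :=
    Finite.of_finite_image (hyp.hKfin.subset (image_mono inter_subset_left))
      ((tproj_injOn_ball n a).mono (inter_subset_right.trans (Metric.ball_subset_ball hr4)))
  rw [← hab, hyp.hlift, hyp.hlift, dist_eq_norm, tproj_sub,
    norm_tproj_of_norm_le_half n (by linarith)]
  exact norm_sub_lt_norm_image_sub hyp.hdiff hyp.hunit hyp.hinvnorm hr0 (hr a) hfin hb
    (fun h => hxy (by rw [h])) hF4

/-- expansiveness along random orbits. There is `ρ₀ > 0` such that any
two points whose random orbits (for the same noise sequence) remain `ρ₀`-close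
forever must coincide. -/
theorem expansiveness_along_random_orbits
    (n : ℕ) (α : ℝ) (f : Torus n → Torus n) (F : (Fin n → ℝ) → Fin n → ℝ)
    (hyp : TorusHyp n α f F) :
    ∃ ρ₀ > (0 : ℝ), ∀ (v : ℕ → Fin n → ℝ) (x y : Torus n),
      dist x y ≤ ρ₀ →
      (∀ j : ℕ, 1 ≤ j → dist (rIter f v j x) (rIter f v j y) ≤ ρ₀) →
      x = y := by
  obtain ⟨ρ₀, hρ₀, hexp⟩ := hyp.exists_dist_lt_dist_image
  obtain ⟨L, -, hL⟩ := hyp.exists_norm_fderiv_le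
  have hf : Continuous f := (LipschitzWith.of_dist_le' fun x y =>
    dist_tproj_le_of_norm_fderiv_le hyp.hlift hyp.hdiff hL x y).continuous
  refine ⟨ρ₀, hρ₀, fun v x y hxy horbit => ?_⟩
  by_contra hne
  have hd0 : 0 < dist x y := dist_pos.2 hne
  have hclose : ∀ j, dist (rIter f v j x) (rIter f v j y) ≤ ρ₀ := fun j => by
    rcases Nat.eq_zero_or_pos j with rfl | hj
    · exact hxy
    · exact horbit j hj
  let S : Set (Torus n × Torus n) := {p | dist x y ≤ dist p.1 p.2 ∧ dist p.1 p.2 ≤ ρ₀}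
  have hS : IsCompact S :=
    ((isClosed_le continuous_const continuous_dist).inter
      (isClosed_le continuous_dist continuous_const)).isCompact
  obtain ⟨p, hpS, hp⟩ := hS.exists_isMinOn ⟨(x, y), le_rfl, hxy⟩
    (f := fun p => dist (f p.1) (f p.2) - dist p.1 p.2) (by fun_prop)
  set δ := dist (f p.1) (f p.2) - dist p.1 p.2
  have hδ : 0 < δ := sub_pos.2 (hexp p.1 p.2 (dist_pos.1 (hd0.trans_le hpS.1)) hpS.2)
  have hgrow : ∀ j : ℕ, dist x y + j * δ ≤ dist (rIter f v j x) (rIter f v j y) := by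
    intro j
    induction j with
    | zero => simp [rIter]
    | succ j ih =>
      have hmem : (rIter f v j x, rIter f v j y) ∈ S :=
        ⟨le_trans (le_add_of_nonneg_right (by positivity)) ih, hclose j⟩
      have hmin : δ ≤ _ := hp hmem
      simp only [rIter, dist_add_right]
      push_cast
      linarith
  obtain ⟨j, hj⟩ := exists_nat_gt (ρ₀ / δ)
  rw [div_lt_iff₀ hδ] at hj
  linarith [hgrow j, hclose j]
end
end

section
/- Fix α ∈ (0,1) and 0 < s ≤ u < 1. For every x ∈ S¹ with dist(x, 0) < p_u and every sequence ω = (ω_1, ω_2, …) ∈ [s,u]^ℕ, one has dist(f_ω^n(x), 0) → 0 as n → ∞. -/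
open MeasureTheory Set Filter Topology

noncomputable section

/-- The circle `S¹ = ℝ/ℤ`. -/
abbrev Circle1 : Type := AddCircle (1 : ℝ)

/-- Lift `F_t` of the map `f_t`: it satisfies `F_t(x+1) = F_t(x) + 2`,
`F_t(x) = t x + 2^α (2-t) x^(1+α)` for `x ∈ [0,1/2)` and
`F_t(x) = 2 - t(1-x) - 2^α (2-t) (1-x)^(1+α)` for `x ∈ [1/2,1)`. -/
noncomputable def Flift (α t x : ℝ) : ℝ :=
  2 * (⌊x⌋ : ℝ) +
    (if Int.fract x < 1 / 2
      then t * Int.fract x + 2 ^ α * (2 - t) * Int.fract x ^ (1 + α)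
      else 2 - t * (1 - Int.fract x) - 2 ^ α * (2 - t) * (1 - Int.fract x) ^ (1 + α))

/-- The circle map `f_t` induced by the lift `F_t`. -/
noncomputable def fmap (α t : ℝ) : Circle1 → Circle1 :=
  AddCircle.liftIco 1 0 (fun x => ((Flift α t x : ℝ) : Circle1))

/-- The fixed point `p_s = (1/2)·((1−s)/(2−s))^(1/α)` of `f_s`. -/
noncomputable def pfix (α s : ℝ) : ℝ := (1 / 2) * ((1 - s) / (2 - s)) ^ (1 / α)

/-- Random iteration: `fIter α ω 0 = id` and
`fIter α ω (n+1) = f_{ω n} ∘ fIter α ω n`. -/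
noncomputable def fIter (α : ℝ) (ω : ℕ → ℝ) : ℕ → Circle1 → Circle1
  | 0 => id
  | n + 1 => fmap α (ω n) ∘ fIter α ω n

/-- `μ` is a stationary measure for the random system given by the family `g`
of maps of the circle and the noise distribution `θ`. -/
def IsStationaryC (g : ℝ → Circle1 → Circle1) (θ : Measure ℝ) (μ : Measure Circle1) : Prop :=
  ∀ φ : C(Circle1, ℝ), ∫ x, ∫ t, φ (g t x) ∂θ ∂μ = ∫ x, φ x ∂μ

/-- `P` is the countable product `θ^ℕ` of copies of the probability measure `θ`. -/
def IsProductOf {Y : Type*} [MeasurableSpace Y] (θ : Measure Y) (P : Measure (ℕ → Y)) : Prop :=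
  IsProbabilityMeasure P ∧ ∀ (k : ℕ) (A : ℕ → Set Y), (∀ i, MeasurableSet (A i)) →
    P {ω | ∀ i < k, ω i ∈ A i} = ∏ i ∈ Finset.range k, θ (A i)


lemma norm_coe_of_le_half {r : ℝ} (hr : |r| ≤ 1 / 2) : ‖(r : Circle1)‖ = |r| :=
  (AddCircle.norm_coe_eq_abs_iff 1 one_ne_zero).2 (by simpa using hr)

lemma norm_fmap_le {α t : ℝ} (ht0 : 0 ≤ t) (ht2 : t ≤ 2) (y : Circle1) :
    ‖fmap α t y‖ ≤ t * ‖y‖ + 2 ^ α * (2 - t) * ‖y‖ ^ (1 + α) := by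
  have hnonneg (d : ℝ) (hd : 0 ≤ d) : 0 ≤ t * d + 2 ^ α * (2 - t) * d ^ (1 + α) := by
    have : 0 ≤ 2 - t := by linarith
    positivity
  obtain ⟨r, ⟨hr0, hr1⟩, rfl⟩ := AddCircle.eq_coe_Ico y
  have hf : Int.fract r = r := Int.fract_eq_self.2 ⟨hr0, hr1⟩
  have hfl : ⌊r⌋ = 0 := Int.floor_eq_zero_iff.2 ⟨hr0, hr1⟩
  rw [fmap, AddCircle.liftIco_coe_apply ⟨hr0, by simpa using hr1⟩, Flift, hf, hfl]
  split_ifs with h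
  · have hn : ‖(r : Circle1)‖ = r := by
      rw [norm_coe_of_le_half (by rw [abs_of_nonneg hr0]; exact h.le), abs_of_nonneg hr0]
    rw [hn]
    refine QuotientAddGroup.norm_mk_le_norm.trans ?_
    rw [Real.norm_eq_abs, Int.cast_zero, mul_zero, zero_add, abs_of_nonneg (hnonneg r hr0)]
  · have hcoe : (r : Circle1) = ((-(1 - r) : ℝ) : Circle1) := by
      rw [neg_sub, AddCircle.coe_sub, AddCircle.coe_period, sub_zero]
    have hn : ‖(r : Circle1)‖ = 1 - r := by
      rw [hcoe, norm_coe_of_le_half] <;> rw [abs_neg, abs_of_nonneg (by linarith)]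
      linarith
    rw [hn]
    have htwo : ((2 : ℝ) : Circle1) = 0 := by
      rw [← one_add_one_eq_two, AddCircle.coe_add, AddCircle.coe_period, add_zero]
    have hval : 2 * ((0 : ℤ) : ℝ) + (2 - t * (1 - r) - 2 ^ α * (2 - t) * (1 - r) ^ (1 + α)) =
        2 - (t * (1 - r) + 2 ^ α * (2 - t) * (1 - r) ^ (1 + α)) := by
      push_cast
      ring
    rw [hval, AddCircle.coe_sub, htwo, zero_sub, norm_neg]
    refine QuotientAddGroup.norm_mk_le_norm.trans ?_
    rw [Real.norm_eq_abs, abs_of_nonneg (hnonneg _ (by linarith))]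

/-- While an orbit stays within distance `d` of `0`, each step with parameter at most `u`
contracts the distance to `0` by the factor `u + (2 - u) (2 * d)^α`, provided `(2 * d)^α ≤ 1`. -/
lemma norm_fmap_le_mul {α t u d : ℝ} (hα : 0 < α) (ht0 : 0 ≤ t) (htu : t ≤ u) (hu : u ≤ 2)
    (hd : (2 * d) ^ α ≤ 1) {y : Circle1} (hy : ‖y‖ ≤ d) :
    ‖fmap α t y‖ ≤ (u + (2 - u) * (2 * d) ^ α) * ‖y‖ := by
  have hy0 : 0 ≤ ‖y‖ := norm_nonneg y
  have hmono : (2 * ‖y‖) ^ α ≤ (2 * d) ^ α := by gcongr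
  have hsplit : ‖y‖ ^ (1 + α) = ‖y‖ * ‖y‖ ^ α := by
    rw [Real.rpow_add' hy0 (by linarith), Real.rpow_one]
  calc ‖fmap α t y‖ ≤ t * ‖y‖ + 2 ^ α * (2 - t) * ‖y‖ ^ (1 + α) :=
        norm_fmap_le ht0 (htu.trans hu) y
    _ = (t + (2 - t) * (2 * ‖y‖) ^ α) * ‖y‖ := by
        rw [hsplit, Real.mul_rpow zero_le_two hy0]
        ring
    _ ≤ (u + (2 - u) * (2 * d) ^ α) * ‖y‖ := by
        refine mul_le_mul_of_nonneg_right ?_ hy0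
        nlinarith [mul_nonneg (sub_nonneg.2 htu) (sub_nonneg.2 hd),
          mul_le_mul_of_nonneg_left hmono (show 0 ≤ 2 - t by linarith)]

lemma two_mul_rpow_lt_of_lt_pfix {α u d : ℝ} (hα : 0 < α) (hu : u < 1) (hd0 : 0 ≤ d)
    (hd : d < pfix α u) : (2 * d) ^ α < (1 - u) / (2 - u) := by
  have hq : 0 ≤ (1 - u) / (2 - u) := div_nonneg (by linarith) (by linarith)
  have h : 2 * d < ((1 - u) / (2 - u)) ^ (1 / α) := by
    rw [pfix] at hd
    linarith
  calc (2 * d) ^ α < (((1 - u) / (2 - u)) ^ (1 / α)) ^ α :=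
        Real.rpow_lt_rpow (by positivity) h hα
    _ = (1 - u) / (2 - u) := by
        rw [← Real.rpow_mul hq, one_div_mul_cancel hα.ne', Real.rpow_one]

/-- every point at distance less than `p_u` from `0` converges to `0`
under every random orbit with parameters in `[s,u]`. -/
theorem random_orbits_tendsto_zero
    (α : ℝ) (hα0 : 0 < α) (hα1 : α < 1)
    (s u : ℝ) (hs : 0 < s) (hsu : s ≤ u) (hu : u < 1)
    (x : Circle1) (hx : dist x (0 : Circle1) < pfix α u)
    (ω : ℕ → ℝ) (hω : ∀ i, ω i ∈ Icc s u) :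
    Tendsto (fun n => dist (fIter α ω n x) (0 : Circle1)) atTop (𝓝 0) := by
  simp only [dist_zero_right] at hx ⊢
  have hlt := two_mul_rpow_lt_of_lt_pfix hα0 hu (norm_nonneg x) hx
  set c := (2 * ‖x‖) ^ α
  have hc0 : 0 ≤ c := by positivity
  have h2u : 0 < 2 - u := by linarith
  rw [lt_div_iff₀ h2u] at hlt
  have hc1 : c ≤ 1 := by nlinarith
  set q := u + (2 - u) * c
  have hq0 : 0 ≤ q := add_nonneg (by linarith) (mul_nonneg h2u.le hc0)
  have hq1 : q < 1 := by linarith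
  have hbound (n : ℕ) : ‖fIter α ω n x‖ ≤ q ^ n * ‖x‖ := by
    induction n with
    | zero => simp [fIter]
    | succ n ih =>
      have hle : ‖fIter α ω n x‖ ≤ ‖x‖ :=
        ih.trans (mul_le_of_le_one_left (norm_nonneg x) (pow_le_one₀ hq0 hq1.le))
      calc ‖fIter α ω (n + 1) x‖ ≤ q * ‖fIter α ω n x‖ :=
            norm_fmap_le_mul hα0 (hs.le.trans (hω n).1) (hω n).2 (by linarith) hc1 hle
        _ ≤ q * (q ^ n * ‖x‖) := by gcongr
        _ = q ^ (n + 1) * ‖x‖ := by ring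
  refine squeeze_zero (fun n => norm_nonneg _) hbound ?_
  simpa using (tendsto_pow_atTop_nhds_zero_of_lt_one hq0 hq1).mul_const ‖x‖
end
end

section
/- Fix α ∈ (0,1) and let 0 < s < u < 1 be such that f_t'(x) > 1 for every t ∈ [s,u] and every x ∈ S¹ with dist(x,0) ≥ p_u. Then for every Borel probability measure θ on [s,u], for θ^ℕ × m-almost every pair (ω, x) ∈ [s,u]^ℕ × S¹ with dist(x,0) ≥ p_u there exists an integer n ≥ 1 such that dist(f_ω^n(x), 0) < p_u, where θ^ℕ denotes the countable product measure on [s,u]^ℕ. -/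
open MeasureTheory Set Filter Topology

noncomputable section

/-- A strictly expanding branch on `[q, 1/2]` reaching `1` at the midpoint, with log-Lipschitz
derivative `D`. -/
structure IsExpandingBranch (q l H : ℝ) (F D : ℝ → ℝ) : Prop where
  measurable : Measurable F
  hasDerivAt : ∀ x ∈ Icc q (1 / 2), HasDerivAt F (D x) x
  le_deriv : ∀ x ∈ Icc q (1 / 2), l ≤ D x
  deriv_le : ∀ x ∈ Icc q (1 / 2), D x ≤ 4
  distortion : ∀ x ∈ Icc q (1 / 2), ∀ y ∈ Icc q (1 / 2), D x ≤ Real.exp (H * |x - y|) * D y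
  left_le : F q ≤ q
  map_half : F (1 / 2) = 1

/-- A positive function on `s` whose logarithm is `C`-Lipschitz. -/
def LogLipschitzOn (C : ℝ) (s : Set ℝ) (φ : ℝ → ℝ) : Prop :=
  ∀ x ∈ s, 0 < φ x ∧ ∀ y ∈ s, φ x ≤ Real.exp (C * |x - y|) * φ y

/-- Points of `[q, 1/2)` that stay there for `n` steps under the folded maps
`x ↦ min (F k x) (1 - F k x)`. -/
def survivors (q : ℝ) : (ℕ → ℝ → ℝ) → ℕ → Set ℝ
  | _, 0 => Ico q (1 / 2)
  | F, n + 1 => {x | x ∈ Ico q (1 / 2) ∧ F 0 x ∈ survivors q (fun k => F (k + 1)) n} ∪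
      {x | x ∈ Ico q (1 / 2) ∧ 1 - F 0 x ∈ survivors q (fun k => F (k + 1)) n}

theorem survivors_subset (q : ℝ) (F : ℕ → ℝ → ℝ) (n : ℕ) :
    survivors q F n ⊆ Ico q (1 / 2) := by
  cases n with
  | zero => exact subset_rfl
  | succ n => exact union_subset (fun x hx => hx.1) (fun x hx => hx.1)

theorem measurableSet_survivors (q : ℝ) (F : ℕ → ℝ → ℝ) (hF : ∀ k, Measurable (F k)) (n : ℕ) :
    MeasurableSet (survivors q F n) := by
  induction n generalizing F with
  | zero => exact measurableSet_Ico
  | succ n ih =>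
    have h := ih (fun k => F (k + 1)) (fun k => hF (k + 1))
    exact (measurableSet_Ico.inter (hF 0 h)).union
      (measurableSet_Ico.inter (((hF 0).const_sub 1) h))

namespace IsExpandingBranch

variable {q l H : ℝ} {F D : ℝ → ℝ}

theorem expands (hF : IsExpandingBranch q l H F D) {x y : ℝ} (hx : x ∈ Icc q (1 / 2))
    (hy : y ∈ Icc q (1 / 2)) (hxy : x ≤ y) : l * (y - x) ≤ F y - F x := by
  refine (convex_Icc q (1 / 2)).mul_sub_le_image_sub_of_le_deriv
    (fun z hz => (hF.hasDerivAt z hz).continuousAt.continuousWithinAt)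
    (fun z hz => (hF.hasDerivAt z (interior_subset hz)).differentiableAt.differentiableWithinAt)
    (fun z hz => ?_) x hx y hy hxy
  rw [(hF.hasDerivAt z (interior_subset hz)).deriv]
  exact hF.le_deriv z (interior_subset hz)

theorem image_sub_le (hF : IsExpandingBranch q l H F D) {x y : ℝ} (hx : x ∈ Icc q (1 / 2))
    (hy : y ∈ Icc q (1 / 2)) (hxy : x ≤ y) : F y - F x ≤ 4 * (y - x) := by
  refine (convex_Icc q (1 / 2)).image_sub_le_mul_sub_of_deriv_le
    (fun z hz => (hF.hasDerivAt z hz).continuousAt.continuousWithinAt)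
    (fun z hz => (hF.hasDerivAt z (interior_subset hz)).differentiableAt.differentiableWithinAt)
    (fun z hz => ?_) x hx y hy hxy
  rw [(hF.hasDerivAt z (interior_subset hz)).deriv]
  exact hF.deriv_le z (interior_subset hz)

theorem mul_abs_sub_le (hF : IsExpandingBranch q l H F D) {x y : ℝ} (hx : x ∈ Icc q (1 / 2))
    (hy : y ∈ Icc q (1 / 2)) : l * |x - y| ≤ |F x - F y| := by
  rcases le_total x y with h | h
  · rw [abs_sub_comm x y, abs_sub_comm (F x), abs_of_nonneg (sub_nonneg.2 h)]
    exact (hF.expands hx hy h).trans (le_abs_self _)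
  · rw [abs_of_nonneg (sub_nonneg.2 h)]
    exact (hF.expands hy hx h).trans (le_abs_self _)

theorem injOn (hF : IsExpandingBranch q l H F D) (hl : 1 < l) : InjOn F (Icc q (1 / 2)) := by
  intro x hx y hy hxy
  have h := hF.mul_abs_sub_le hx hy
  rw [hxy, sub_self, abs_zero] at h
  have : |x - y| ≤ 0 := by nlinarith [abs_nonneg (x - y)]
  exact sub_eq_zero.1 (abs_nonpos_iff.1 this)

/-- The transfer operator of a branch preserves log-Lipschitz densities. -/
theorem exists_transfer (hF : IsExpandingBranch q l H F D) (hq : 0 < q) (hq2 : q ≤ 1 / 4)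
    (hl : 1 < l) {C : ℝ} (hC : 0 ≤ C + H) (hCl : C + H ≤ C * l) {φ : ℝ → ℝ}
    (hφ : LogLipschitzOn C (Icc q (1 / 2)) φ) :
    ∃ ψ, LogLipschitzOn C (Icc q (1 - q)) ψ ∧ ∀ E ⊆ Icc q (1 - q), MeasurableSet E →
      ∫⁻ x in {x | x ∈ Ico q (1 / 2) ∧ F x ∈ E}, ENNReal.ofReal (φ x) =
        ∫⁻ y in E, ENNReal.ofReal (ψ y) := by
  have hsurj : ∀ y ∈ Icc q (1 - q), ∃ x ∈ Icc q (1 / 2), F x = y := by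
    intro y hy
    have hcont : ContinuousOn F (Icc q (1 / 2)) :=
      fun z hz => (hF.hasDerivAt z hz).continuousAt.continuousWithinAt
    refine intermediate_value_Icc (by linarith) hcont ⟨hF.left_le.trans hy.1, ?_⟩
    rw [hF.map_half]
    linarith [hy.2]
  choose! g hgI hFg using hsurj
  have hgF : ∀ x ∈ Icc q (1 / 2), F x ∈ Icc q (1 - q) → g (F x) = x := fun x hx hFx =>
    hF.injOn hl (hgI _ hFx) hx (hFg _ hFx)
  have hD : ∀ x ∈ Icc q (1 / 2), 0 < D x := fun x hx => by linarith [hF.le_deriv x hx]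
  refine ⟨fun y => φ (g y) / D (g y), fun x hx => ⟨div_pos (hφ _ (hgI x hx)).1
    (hD _ (hgI x hx)), fun y hy => ?_⟩, fun E hE hEm => ?_⟩
  · have h1 := (hφ _ (hgI x hx)).2 _ (hgI y hy)
    have h2 := hF.distortion _ (hgI y hy) _ (hgI x hx)
    have h3 := hF.mul_abs_sub_le (hgI x hx) (hgI y hy)
    rw [hFg x hx, hFg y hy] at h3
    have hx0 := hD _ (hgI x hx)
    have hy0 := hD _ (hgI y hy)
    have hφy := (hφ _ (hgI y hy)).1
    rw [abs_sub_comm (g y)] at h2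
    have h4 : (C + H) * |g x - g y| ≤ C * |x - y| := by
      have hC0 : 0 ≤ C := by nlinarith
      calc (C + H) * |g x - g y| ≤ C * l * |g x - g y| := by gcongr
        _ = C * (l * |g x - g y|) := by ring
        _ ≤ C * |x - y| := by gcongr
    rw [← mul_div_assoc, div_le_div_iff₀ hx0 hy0]
    calc φ (g x) * D (g y)
        ≤ (Real.exp (C * |g x - g y|) * φ (g y)) * (Real.exp (H * |g x - g y|) * D (g x)) := by
          gcongr
      _ = Real.exp ((C + H) * |g x - g y|) * φ (g y) * D (g x) := by
          rw [add_mul, Real.exp_add]; ring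
      _ ≤ Real.exp (C * |x - y|) * φ (g y) * D (g x) := by gcongr
  · set s : Set ℝ := {x | x ∈ Ico q (1 / 2) ∧ F x ∈ E}
    have hsI : ∀ x ∈ s, x ∈ Icc q (1 / 2) := fun x hx => Ico_subset_Icc_self hx.1
    have hs : MeasurableSet s := measurableSet_Ico.inter (hF.measurable hEm)
    have himg : F '' s = E := by
      ext y
      constructor
      · rintro ⟨x, hx, rfl⟩
        exact hx.2
      · intro hy
        refine ⟨g y, ⟨⟨(hgI y (hE hy)).1, lt_of_le_of_ne (hgI y (hE hy)).2 fun h => ?_⟩, ?_⟩,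
          hFg y (hE hy)⟩
        · have h1 := hFg y (hE hy)
          rw [h, hF.map_half] at h1
          linarith [(hE hy).2]
        · rwa [hFg y (hE hy)]
    rw [← himg, lintegral_image_eq_lintegral_abs_deriv_mul hs
      (fun x hx => (hF.hasDerivAt x (hsI x hx)).hasDerivWithinAt)
      ((hF.injOn hl).mono hsI)]
    refine setLIntegral_congr_fun hs fun x hx => ?_
    have hDx := hD x (hsI x hx)
    simp only
    rw [hgF x (hsI x hx) (hE hx.2), ← ENNReal.ofReal_mul (abs_nonneg _), abs_of_pos hDx,
      mul_div_cancel₀ _ hDx.ne']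

theorem exists_transfer_pair (hF : IsExpandingBranch q l H F D) (hq : 0 < q) (hq2 : q ≤ 1 / 4)
    (hl : 1 < l) {C : ℝ} (hC : 0 ≤ C + H) (hCl : C + H ≤ C * l) {φ : ℝ → ℝ}
    (hφ : LogLipschitzOn C (Icc q (1 / 2)) φ) :
    ∃ ψ₀ ψ₁, LogLipschitzOn C (Icc q (1 / 2)) ψ₀ ∧ LogLipschitzOn C (Icc q (1 / 2)) ψ₁ ∧
      ∀ E ⊆ Ico q (1 / 2), MeasurableSet E →
        ∫⁻ x in {x | x ∈ Ico q (1 / 2) ∧ F x ∈ E}, ENNReal.ofReal (φ x) =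
          ∫⁻ y in E, ENNReal.ofReal (ψ₀ y) ∧
        ∫⁻ x in {x | x ∈ Ico q (1 / 2) ∧ 1 - F x ∈ E}, ENNReal.ofReal (φ x) =
          ∫⁻ y in E, ENNReal.ofReal (ψ₁ y) := by
  obtain ⟨ψ, hψ, hint⟩ := hF.exists_transfer hq hq2 hl hC hCl hφ
  have hsub : Icc q (1 / 2) ⊆ Icc q (1 - q) := Icc_subset_Icc_right (by linarith)
  have hrefl : ∀ x ∈ Icc q (1 / 2), 1 - x ∈ Icc q (1 - q) := fun x hx =>
    ⟨by linarith [hx.2], by linarith [hx.1]⟩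
  refine ⟨ψ, fun y => ψ (1 - y), fun x hx => ⟨(hψ x (hsub hx)).1, fun y hy =>
    (hψ x (hsub hx)).2 y (hsub hy)⟩, fun x hx => ⟨(hψ _ (hrefl x hx)).1, fun y hy => ?_⟩,
    fun E hE hEm => ⟨hint E ((hE.trans Ico_subset_Icc_self).trans hsub) hEm, ?_⟩⟩
  · have h := (hψ _ (hrefl x hx)).2 _ (hrefl y hy)
    rwa [sub_sub_sub_cancel_left, abs_sub_comm] at h
  · have hm : MeasurableSet ((fun y : ℝ => 1 - y) ⁻¹' E) := (measurable_id.const_sub 1) hEm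
    have h1 := hint ((fun y : ℝ => 1 - y) ⁻¹' E) (fun y hy => by
      have := hE hy
      constructor <;> linarith [this.1, this.2]) hm
    refine h1.trans ?_
    have h2 := (Measure.measurePreserving_sub_left (volume : Measure ℝ) 1).setLIntegral_comp_preimage_emb
      (MeasurableEquiv.subLeft (1 : ℝ)).measurableEmbedding
      (fun y => ENNReal.ofReal (ψ (1 - y))) E
    simpa using h2

/-- A fixed proportion of the mass of a log-Lipschitz density escapes in one step. -/
theorem escape (hF : IsExpandingBranch q l H F D) (hq : 0 < q) (hq2 : q ≤ 1 / 4)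
    {C : ℝ} (hC : 0 ≤ C) {φ : ℝ → ℝ} (hφ : LogLipschitzOn C (Icc q (1 / 2)) φ) :
    (∫⁻ x in {x | x ∈ Ico q (1 / 2) ∧ F x ∈ Ico q (1 / 2)}, ENNReal.ofReal (φ x)) +
      ∫⁻ x in {x | x ∈ Ico q (1 / 2) ∧ 1 - F x ∈ Ico q (1 / 2)}, ENNReal.ofReal (φ x) ≤
    (1 + ENNReal.ofReal (q / 4 * Real.exp (-(2 * C))))⁻¹ *
      ∫⁻ x in Ico q (1 / 2), ENNReal.ofReal (φ x) := by
  set I := ∫⁻ x in Ico q (1 / 2), ENNReal.ofReal (φ x)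
  set S₀ : Set ℝ := {x | x ∈ Ico q (1 / 2) ∧ F x ∈ Ico q (1 / 2)}
  set S₁ : Set ℝ := {x | x ∈ Ico q (1 / 2) ∧ 1 - F x ∈ Ico q (1 / 2)}
  set G : Set ℝ := Ioo (1 / 2 - q / 4) (1 / 2)
  have hqI : q ∈ Icc q (1 / 2) := ⟨le_rfl, by linarith⟩
  have hφq := (hφ q hqI).1
  have hS₁ : MeasurableSet S₁ := measurableSet_Ico.inter ((hF.measurable.const_sub 1)
    measurableSet_Ico)
  have hd₁ : Disjoint S₀ S₁ := Set.disjoint_left.2 fun x h0 h1 => by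
    have := h0.2.2
    have := h1.2.2
    linarith
  have hGI : G ⊆ Ico q (1 / 2) := fun x hx => ⟨by linarith [hx.1], hx.2⟩
  have hd₂ : Disjoint (S₀ ∪ S₁) G := Set.disjoint_left.2 fun x h hx => by
    have h1 := hF.image_sub_le (Ico_subset_Icc_self (hGI hx)) ⟨by linarith, le_rfl⟩ hx.2.le
    rw [hF.map_half] at h1
    have h2 := hx.1
    rcases h with h | h
    · linarith [h.2.2]
    · linarith [h.2.1]
  have hsum : (∫⁻ x in S₀, ENNReal.ofReal (φ x)) + (∫⁻ x in S₁, ENNReal.ofReal (φ x)) +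
      ∫⁻ x in G, ENNReal.ofReal (φ x) ≤ I := by
    rw [← lintegral_union hS₁ hd₁, ← lintegral_union measurableSet_Ioo hd₂]
    exact lintegral_mono_set (union_subset (union_subset (fun x hx => hx.1) fun x hx => hx.1) hGI)
  have habs : ∀ x ∈ Icc q (1 / 2), |x - q| ≤ 1 := fun x hx => by
    rw [abs_le]; constructor <;> linarith [hx.1, hx.2]
  have hI : I ≤ ENNReal.ofReal (Real.exp C * φ q) := by
    calc I ≤ ∫⁻ x in Ico q (1 / 2), ENNReal.ofReal (Real.exp C * φ q) := by
          refine setLIntegral_mono' measurableSet_Ico fun x hx => ENNReal.ofReal_le_ofReal ?_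
          refine ((hφ x (Ico_subset_Icc_self hx)).2 q hqI).trans ?_
          gcongr
          nlinarith [habs x (Ico_subset_Icc_self hx)]
      _ = ENNReal.ofReal (Real.exp C * φ q) * ENNReal.ofReal (1 / 2 - q) := by
          rw [setLIntegral_const, Real.volume_Ico]
      _ ≤ ENNReal.ofReal (Real.exp C * φ q) * 1 := by
          gcongr
          exact ENNReal.ofReal_le_one.2 (by linarith)
      _ = _ := mul_one _
  have hG : ENNReal.ofReal (q / 4 * Real.exp (-(2 * C))) * I ≤
      ∫⁻ x in G, ENNReal.ofReal (φ x) := by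
    calc ENNReal.ofReal (q / 4 * Real.exp (-(2 * C))) * I
        ≤ ENNReal.ofReal (q / 4 * Real.exp (-(2 * C))) * ENNReal.ofReal (Real.exp C * φ q) := by
          gcongr
      _ = ENNReal.ofReal (Real.exp (-C) * φ q) * ENNReal.ofReal (q / 4) := by
          rw [← ENNReal.ofReal_mul (by positivity), ← ENNReal.ofReal_mul (by positivity)]
          congr 1
          have : Real.exp (-(2 * C)) * Real.exp C = Real.exp (-C) := by
            rw [← Real.exp_add]; congr 1; ring
          rw [← this]; ring
      _ = ∫⁻ x in G, ENNReal.ofReal (Real.exp (-C) * φ q) := by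
          rw [setLIntegral_const, Real.volume_Ioo]
          congr 2
          ring
      _ ≤ ∫⁻ x in G, ENNReal.ofReal (φ x) := by
          refine setLIntegral_mono' measurableSet_Ioo fun x hx => ENNReal.ofReal_le_ofReal ?_
          have hxI := Ico_subset_Icc_self (hGI hx)
          have h1 := (hφ q hqI).2 x hxI
          have h2 : Real.exp (C * |q - x|) ≤ Real.exp C := by
            rw [abs_sub_comm]
            exact Real.exp_le_exp.2 (by nlinarith [habs x hxI])
          have h3 := (hφ x hxI).1
          rw [Real.exp_neg, inv_mul_le_iff₀ (Real.exp_pos _)]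
          exact h1.trans (by gcongr)
  set S := (∫⁻ x in S₀, ENNReal.ofReal (φ x)) + ∫⁻ x in S₁, ENNReal.ofReal (φ x)
  set κ := ENNReal.ofReal (q / 4 * Real.exp (-(2 * C)))
  have hSI : S ≤ I := le_self_add.trans hsum
  rw [mul_comm, ← div_eq_mul_inv, ENNReal.le_div_iff_mul_le (by simp) (by simp [κ]), mul_add,
    mul_one, mul_comm S]
  calc S + κ * S ≤ S + κ * I := by gcongr
    _ ≤ S + ∫⁻ x in G, ENNReal.ofReal (φ x) := by gcongr
    _ ≤ I := hsum

end IsExpandingBranch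

theorem lintegral_survivors_le {q l H : ℝ} (hq : 0 < q) (hq2 : q ≤ 1 / 4) (hl : 1 < l) {C : ℝ}
    (hC : 0 ≤ C) (hCH : 0 ≤ C + H) (hCl : C + H ≤ C * l) (n : ℕ) (F D : ℕ → ℝ → ℝ)
    (hF : ∀ k, IsExpandingBranch q l H (F k) (D k)) (φ : ℝ → ℝ)
    (hφ : LogLipschitzOn C (Icc q (1 / 2)) φ) :
    ∫⁻ x in survivors q F n, ENNReal.ofReal (φ x) ≤
      (1 + ENNReal.ofReal (q / 4 * Real.exp (-(2 * C))))⁻¹ ^ n *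
        ∫⁻ x in Ico q (1 / 2), ENNReal.ofReal (φ x) := by
  induction n generalizing F D φ with
  | zero => simp [survivors]
  | succ n ih =>
    obtain ⟨ψ₀, ψ₁, h₀, h₁, hint⟩ := (hF 0).exists_transfer_pair hq hq2 hl hCH hCl hφ
    have hsurv := hint _ (survivors_subset q (fun k => F (k + 1)) n)
      (measurableSet_survivors q _ (fun k => (hF (k + 1)).measurable) n)
    have hI := hint _ subset_rfl measurableSet_Ico
    have hesc := (hF 0).escape hq hq2 hC hφ
    rw [hI.1, hI.2] at hesc
    refine (lintegral_union_le _ _ _).trans ?_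
    rw [hsurv.1, hsurv.2]
    refine (add_le_add (ih _ _ (fun k => hF (k + 1)) ψ₀ h₀)
      (ih _ _ (fun k => hF (k + 1)) ψ₁ h₁)).trans ?_
    rw [← mul_add, pow_succ, mul_assoc]
    gcongr

theorem volume_iInter_survivors {q l H : ℝ} (hq : 0 < q) (hq2 : q ≤ 1 / 4) (hl : 1 < l)
    (hH : 0 ≤ H) (F D : ℕ → ℝ → ℝ) (hF : ∀ k, IsExpandingBranch q l H (F k) (D k)) :
    volume (⋂ n, survivors q F n) = 0 := by
  have hl' : 0 < l - 1 := by linarith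
  set C := H / (l - 1) with hCdef
  have hC : 0 ≤ C := by positivity
  have hCl : C + H = C * l := by rw [hCdef]; field_simp; ring
  set ρ := (1 + ENNReal.ofReal (q / 4 * Real.exp (-(2 * C))))⁻¹
  have hρ : ρ < 1 := by
    refine ENNReal.inv_lt_one.2 (ENNReal.lt_add_right ENNReal.one_ne_top ?_)
    exact (ENNReal.ofReal_pos.2 (by positivity)).ne'
  have hle : ∀ n, volume (⋂ n, survivors q F n) ≤ ρ ^ n := fun n => by
    have h := lintegral_survivors_le hq hq2 hl hC (by positivity) hCl.le n F D hF (fun _ => 1)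
      (fun x _ => ⟨one_pos, fun y _ => by
        rw [mul_one]; exact Real.one_le_exp (by positivity)⟩)
    simp only [ENNReal.ofReal_one, setLIntegral_const, one_mul, Real.volume_Ico] at h
    refine (measure_mono (iInter_subset _ n)).trans (h.trans ?_)
    calc _ ≤ ρ ^ n * 1 := by
          gcongr
          exact ENNReal.ofReal_le_one.2 (by linarith)
      _ = ρ ^ n := mul_one _
  exact le_antisymm (ge_of_tendsto' (ENNReal.tendsto_pow_atTop_nhds_zero_of_lt_one hρ) hle)
    zero_le

/-- The branch of `Flift α t` on `[0, 1/2)`, as a function on `ℝ`. -/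
def leftBranch (α t x : ℝ) : ℝ := t * x + 2 ^ α * (2 - t) * x ^ (1 + α)

/-- The derivative of `leftBranch α t` on the positive half-line. -/
def leftBranchDeriv (α t x : ℝ) : ℝ := t + 2 ^ α * (2 - t) * ((1 + α) * x ^ α)

theorem hasDerivAt_leftBranch (α t : ℝ) {x : ℝ} (hx : 0 < x) :
    HasDerivAt (leftBranch α t) (leftBranchDeriv α t x) x := by
  have h := (Real.hasDerivAt_rpow_const (x := x) (p := 1 + α) (Or.inl hx.ne')).const_mul
    (2 ^ α * (2 - t))
  have h2 := ((hasDerivAt_id x).const_mul t).add h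
  rw [add_sub_cancel_left, mul_one] at h2
  exact h2

theorem Flift_eq_leftBranch (α t : ℝ) {x : ℝ} (h0 : 0 ≤ x) (h1 : x < 1 / 2) :
    Flift α t x = leftBranch α t x := by
  have hfr : Int.fract x = x := Int.fract_eq_self.2 ⟨h0, by linarith⟩
  have hfl : ⌊x⌋ = 0 := Int.floor_eq_zero_iff.2 ⟨h0, by linarith⟩
  simp only [Flift, hfr, hfl, if_pos h1, leftBranch]
  simp

theorem Flift_eq_two_sub_leftBranch (α t : ℝ) {x : ℝ} (h0 : 1 / 2 ≤ x) (h1 : x < 1) :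
    Flift α t x = 2 - leftBranch α t (1 - x) := by
  have hfr : Int.fract x = x := Int.fract_eq_self.2 ⟨by linarith, h1⟩
  have hfl : ⌊x⌋ = 0 := Int.floor_eq_zero_iff.2 ⟨by linarith, h1⟩
  simp only [Flift, hfr, hfl, if_neg (not_lt.2 h0), leftBranch]
  push_cast
  ring

theorem deriv_Flift (α t : ℝ) {x : ℝ} (h0 : 0 < x) (h1 : x < 1 / 2) :
    deriv (Flift α t) x = leftBranchDeriv α t x := by
  have h : Flift α t =ᶠ[𝓝 x] leftBranch α t := by
    filter_upwards [Ioo_mem_nhds h0 h1] with y hy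
    exact Flift_eq_leftBranch α t hy.1.le hy.2
  rw [h.deriv_eq, (hasDerivAt_leftBranch α t h0).deriv]

theorem leftBranch_half (α t : ℝ) : leftBranch α t (1 / 2) = 1 := by
  have h : (2 : ℝ) ^ α * (1 / 2) ^ α = 1 := by
    rw [← Real.mul_rpow (by norm_num) (by norm_num)]
    norm_num
  rw [leftBranch, Real.rpow_add (by norm_num), Real.rpow_one]
  linear_combination (2 - t) / 2 * h

theorem measurable_leftBranch (α : ℝ) : Measurable fun p : ℝ × ℝ => leftBranch α p.1 p.2 := by
  unfold leftBranch
  fun_prop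

theorem ratio_mem {u : ℝ} (hu : u < 1) : 0 < (1 - u) / (2 - u) :=
  div_pos (by linarith) (by linarith)

theorem pfix_pos (α : ℝ) {u : ℝ} (hu : u < 1) : 0 < pfix α u :=
  mul_pos (by norm_num) (Real.rpow_pos_of_pos (ratio_mem hu) _)

theorem pfix_le {α u : ℝ} (hα0 : 0 < α) (hα1 : α < 1) (hu0 : 0 < u) (hu : u < 1) :
    pfix α u ≤ 1 / 4 := by
  have h1 : (1 - u) / (2 - u) ≤ 1 / 2 := by
    rw [div_le_div_iff₀ (by linarith) (by norm_num)]
    linarith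
  have h2 : ((1 - u) / (2 - u)) ^ (1 / α) ≤ ((1 - u) / (2 - u)) ^ (1 : ℝ) :=
    Real.rpow_le_rpow_of_exponent_ge (ratio_mem hu) (by linarith)
      ((one_le_div hα0).2 hα1.le)
  rw [Real.rpow_one] at h2
  rw [pfix]
  linarith

theorem two_rpow_mul_pfix_rpow {α u : ℝ} (hα0 : 0 < α) (hu : u < 1) :
    2 ^ α * pfix α u ^ α = (1 - u) / (2 - u) := by
  rw [← Real.mul_rpow (by norm_num) (pfix_pos α hu).le, pfix, ← mul_assoc]
  norm_num
  rw [Real.rpow_inv_rpow (ratio_mem hu).le hα0.ne']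

theorem leftBranch_pfix_le {α t u : ℝ} (hα0 : 0 < α) (htu : t ≤ u) (hu : u < 1) :
    leftBranch α t (pfix α u) ≤ pfix α u := by
  have hq := pfix_pos α hu
  have h := two_rpow_mul_pfix_rpow hα0 hu
  have h1 : leftBranch α t (pfix α u) = pfix α u * (t + (2 - t) * ((1 - u) / (2 - u))) := by
    rw [leftBranch, Real.rpow_add hq, Real.rpow_one, ← h]
    ring
  have h2 : t + (2 - t) * ((1 - u) / (2 - u)) ≤ 1 := by
    have h3 : (0 : ℝ) < 2 - u := by linarith
    rw [← mul_div_assoc, ← sub_nonneg]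
    have : 1 - (t + (2 - t) * (1 - u) / (2 - u)) = (u - t) / (2 - u) := by
      field_simp
      ring
    rw [this]
    exact div_nonneg (by linarith) h3.le
  rw [h1]
  nlinarith

theorem leftBranchDeriv_mono {α t x y : ℝ} (hα0 : 0 < α) (ht : t ≤ 2) (hx : 0 ≤ x) (hxy : x ≤ y) :
    leftBranchDeriv α t x ≤ leftBranchDeriv α t y := by
  have : 0 ≤ 2 - t := by linarith
  unfold leftBranchDeriv
  gcongr

theorem leftBranchDeriv_half (α t : ℝ) :
    leftBranchDeriv α t (1 / 2) = t + (2 - t) * (1 + α) := by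
  have h : (2 : ℝ) ^ α * (1 / 2) ^ α = 1 := by
    rw [← Real.mul_rpow (by norm_num) (by norm_num)]
    norm_num
  rw [leftBranchDeriv]
  linear_combination (2 - t) * (1 + α) * h

theorem leftBranch_mem_Icc {α t x : ℝ} (hα0 : 0 < α) (ht0 : 0 ≤ t) (ht : t ≤ 2)
    (hx : x ∈ Icc (0 : ℝ) (1 / 2)) : leftBranch α t x ∈ Icc (0 : ℝ) 1 := by
  have h2 : 0 ≤ 2 - t := by linarith
  have hx0 := hx.1
  refine ⟨by unfold leftBranch; positivity, ?_⟩
  rw [← leftBranch_half α t]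
  unfold leftBranch
  gcongr <;> exact hx.2

theorem abs_rpow_sub_rpow_le {α q x y : ℝ} (hα0 : 0 < α) (hα1 : α < 1) (hq : 0 < q)
    (hx : q ≤ x) (hy : q ≤ y) : |x ^ α - y ^ α| ≤ α * q ^ (α - 1) * |x - y| := by
  refine Convex.norm_image_sub_le_of_norm_hasDerivWithin_le (s := Ici q)
    (f' := fun z => α * z ^ (α - 1))
    (fun z hz => (Real.hasDerivAt_rpow_const (Or.inl (hq.trans_le hz).ne')).hasDerivWithinAt)
    (fun z hz => ?_) (convex_Ici q) hy hx
  have hz0 : 0 < z := hq.trans_le hz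
  rw [Real.norm_of_nonneg (by positivity)]
  exact mul_le_mul_of_nonneg_left (Real.rpow_le_rpow_of_nonpos hq hz (by linarith)) hα0.le

theorem isExpandingBranch_leftBranch {α t q u l : ℝ} (hα0 : 0 < α) (hα1 : α < 1) (ht0 : 0 ≤ t)
    (htu : t ≤ u) (hu : u < 1) (hq : q = pfix α u) (hl : 1 ≤ l) (hlt : l ≤ leftBranchDeriv α t q) :
    IsExpandingBranch q l (2 ^ α * 2 * ((1 + α) * (α * q ^ (α - 1)))) (leftBranch α t)
      (leftBranchDeriv α t) := by
  have hq0 : 0 < q := hq ▸ pfix_pos α hu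
  have hlow : ∀ x ∈ Icc q (1 / 2), l ≤ leftBranchDeriv α t x := fun x hx =>
    hlt.trans (leftBranchDeriv_mono hα0 (by linarith) hq0.le hx.1)
  refine ⟨(measurable_leftBranch α).comp (measurable_const.prodMk measurable_id), fun x hx =>
    hasDerivAt_leftBranch α t (hq0.trans_le hx.1), hlow, fun x hx => ?_, fun x hx y hy => ?_,
    hq ▸ leftBranch_pfix_le hα0 htu hu, leftBranch_half α t⟩
  · refine (leftBranchDeriv_mono hα0 (by linarith) (hq0.le.trans hx.1) hx.2).trans ?_
    rw [leftBranchDeriv_half]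
    nlinarith
  · set L := α * q ^ (α - 1)
    have hL : 0 ≤ L := by positivity
    set H := (2 : ℝ) ^ α * 2 * ((1 + α) * L)
    have hH : 0 ≤ H := by positivity
    have h1 : 1 ≤ leftBranchDeriv α t y := hl.trans (hlow y hy)
    have h2 : x ^ α - y ^ α ≤ L * |x - y| :=
      (le_abs_self _).trans (abs_rpow_sub_rpow_le hα0 hα1 hq0 hx.1 hy.1)
    have h3 : leftBranchDeriv α t x - leftBranchDeriv α t y ≤ H * |x - y| := by
      have h4 : 0 ≤ 2 - t := by linarith
      calc leftBranchDeriv α t x - leftBranchDeriv α t y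
          = 2 ^ α * (2 - t) * ((1 + α) * (x ^ α - y ^ α)) := by unfold leftBranchDeriv; ring
        _ ≤ 2 ^ α * (2 - t) * ((1 + α) * (L * |x - y|)) := by gcongr
        _ ≤ 2 ^ α * 2 * ((1 + α) * (L * |x - y|)) := by gcongr; linarith
        _ = H * |x - y| := by ring
    have h5 : 0 ≤ H * |x - y| := by positivity
    calc leftBranchDeriv α t x ≤ (H * |x - y| + 1) * leftBranchDeriv α t y := by nlinarith
      _ ≤ Real.exp (H * |x - y|) * leftBranchDeriv α t y := by
        gcongr
        exact Real.add_one_le_exp _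

theorem norm_coe_circle {y : ℝ} (h : |y| ≤ 1 / 2) : ‖(y : Circle1)‖ = |y| :=
  (AddCircle.norm_coe_eq_abs_iff 1 one_ne_zero).2 (by rwa [abs_one])

theorem norm_coe_circle_eq_one_sub {y : ℝ} (h0 : 1 / 2 ≤ y) (h1 : y ≤ 1) :
    ‖(y : Circle1)‖ = 1 - y := by
  have h : (y : Circle1) = ((y - 1 : ℝ) : Circle1) := by
    rw [AddCircle.coe_sub, AddCircle.coe_period, sub_zero]
  rw [h, norm_coe_circle (by rw [abs_le]; constructor <;> linarith), abs_of_nonpos (by linarith)]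
  ring

theorem norm_circle_le_half (x : Circle1) : ‖x‖ ≤ 1 / 2 := by
  simpa using AddCircle.norm_le_half_period 1 (x := x) one_ne_zero

/-- Folded by `x ↦ dist x 0`, the circle map becomes the left branch modulo reflection. -/
theorem norm_fmap (α t : ℝ) (x : Circle1) :
    ‖fmap α t x‖ = ‖(leftBranch α t ‖x‖ : Circle1)‖ := by
  obtain ⟨r, ⟨h0, h1⟩, rfl⟩ := AddCircle.eq_coe_Ico x
  rw [fmap, AddCircle.liftIco_coe_apply ⟨h0, by linarith⟩]
  rcases lt_or_ge r (1 / 2) with h | h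
  · rw [Flift_eq_leftBranch α t h0 h, norm_coe_circle (y := r) (by rw [abs_of_nonneg h0]; exact h.le),
      abs_of_nonneg h0]
  · rw [Flift_eq_two_sub_leftBranch α t h h1, norm_coe_circle_eq_one_sub h h1.le]
    have h2 : ((2 : ℝ) : Circle1) = 0 := by
      rw [show (2 : ℝ) = 1 + 1 by norm_num, AddCircle.coe_add, AddCircle.coe_period, add_zero]
    rw [AddCircle.coe_sub, h2, zero_sub, norm_neg]

theorem fIter_succ' (α : ℝ) (ω : ℕ → ℝ) (n : ℕ) (x : Circle1) :
    fIter α ω (n + 1) x = fIter α (fun k => ω (k + 1)) n (fmap α (ω 0) x) := by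
  induction n with
  | zero => rfl
  | succ n ih =>
    change fmap α (ω (n + 1)) (fIter α ω (n + 1) x) = _
    rw [ih]
    rfl

theorem norm_mem_survivors {α q : ℝ} (hα0 : 0 < α) (hq : 0 < q) (n : ℕ) (ω : ℕ → ℝ)
    (hω : ∀ k, ω k ∈ Icc (0 : ℝ) 2) (x : Circle1) (hx : ∀ k, q ≤ ‖fIter α ω k x‖) :
    ‖x‖ ∈ survivors q (fun k => leftBranch α (ω k)) n := by
  have hmem : ‖x‖ ∈ Ico q (1 / 2) := by
    refine ⟨hx 0, lt_of_le_of_ne (norm_circle_le_half x) fun h => ?_⟩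
    have h1 : q ≤ ‖fmap α (ω 0) x‖ := hx 1
    rw [norm_fmap, h, leftBranch_half, AddCircle.coe_period, norm_zero] at h1
    linarith
  cases n with
  | zero => exact hmem
  | succ n =>
    have hx' : ∀ k, q ≤ ‖fIter α (fun k => ω (k + 1)) k (fmap α (ω 0) x)‖ := fun k => by
      rw [← fIter_succ']
      exact hx (k + 1)
    have h1 := norm_mem_survivors hα0 hq n (fun k => ω (k + 1)) (fun k => hω (k + 1)) _ hx'
    rw [norm_fmap] at h1
    have h2 := leftBranch_mem_Icc hα0 (hω 0).1 (hω 0).2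
      ⟨norm_nonneg x, norm_circle_le_half x⟩
    rcases le_total (leftBranch α (ω 0) ‖x‖) (1 / 2) with h | h
    · rw [norm_coe_circle (by rwa [abs_of_nonneg h2.1]), abs_of_nonneg h2.1] at h1
      exact Or.inl ⟨hmem, h1⟩
    · rw [norm_coe_circle_eq_one_sub h h2.2] at h1
      exact Or.inr ⟨hmem, h1⟩

theorem measurable_norm_fIter (α : ℝ) (n : ℕ) :
    Measurable fun p : (ℕ → ℝ) × Circle1 => ‖fIter α p.1 n p.2‖ := by
  induction n with
  | zero => exact measurable_snd.norm
  | succ n ih =>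
    change Measurable fun p : (ℕ → ℝ) × Circle1 => ‖fmap α (p.1 n) (fIter α p.1 n p.2)‖
    simp only [norm_fmap]
    have h1 : Measurable fun y : ℝ => ‖(y : Circle1)‖ :=
      (continuous_norm.comp (AddCircle.continuous_mk' 1)).measurable
    exact h1.comp ((measurable_leftBranch α).comp
      (((measurable_pi_apply n).comp measurable_fst).prodMk ih))

theorem IsProductOf.ae_forall_mem {Y : Type*} [MeasurableSpace Y] {θ : Measure Y}
    [IsProbabilityMeasure θ] {P : Measure (ℕ → Y)} (hP : IsProductOf θ P) {A : Set Y}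
    (hA : MeasurableSet A) (hθA : θ Aᶜ = 0) : ∀ᵐ ω ∂P, ∀ k, ω k ∈ A := by
  have := hP.1
  rw [ae_all_iff]
  intro k
  have hm : MeasurableSet {ω : ℕ → Y | ∀ i < k + 1, ω i ∈ A} := by
    simp only [ofPred_forall]
    exact MeasurableSet.iInter fun i => MeasurableSet.iInter fun _ => measurable_pi_apply i hA
  have h := hP.2 (k + 1) (fun _ => A) fun _ => hA
  rw [(prob_compl_eq_zero_iff hA).1 hθA, Finset.prod_const_one] at h
  have h2 : ∀ᵐ ω ∂P, ω ∈ {ω : ℕ → Y | ∀ i < k + 1, ω i ∈ A} := (prob_compl_eq_zero_iff hm).2 h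
  filter_upwards [h2] with ω hω
  exact hω k (Nat.lt_succ_self k)

theorem volume_norm_preimage_eq_zero {N : Set ℝ} (hN : volume N = 0) {B : Set Circle1}
    (hB : MeasurableSet B) (hBN : ∀ x ∈ B, ‖x‖ ∈ N) : volume B = 0 := by
  rw [← (AddCircle.measurePreserving_mk 1 (-(1 / 2))).measure_preimage hB.nullMeasurableSet,
    Measure.restrict_apply ((AddCircle.measurable_mk' (a := (1 : ℝ))) hB)]
  refine measure_mono_null (t := N ∪ -N) ?_ (measure_union_null hN (by rwa [Measure.measure_neg]))
  rintro x ⟨hx, h1, h2⟩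
  have h3 := hBN _ hx
  have h4 : |x| ≤ 1 / 2 := abs_le.2 ⟨h1.le, by linarith⟩
  change ‖(x : Circle1)‖ ∈ N at h3
  rw [norm_coe_circle h4] at h3
  rcases abs_choice x with h | h <;> rw [h] at h3
  · exact Or.inl h3
  · exact Or.inr h3

/-- if `f_t' > 1` on `{dist(·,0) ≥ p_u}` for all `t ∈ [s,u]`, then for
every probability `θ` on `[s,u]`, `θ^ℕ × m`-almost every pair `(ω,x)` with
`dist(x,0) ≥ p_u` eventually enters `{dist(·,0) < p_u}` under the random orbit. -/
theorem almost_every_orbit_enters_neighborhood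
    (α : ℝ) (hα0 : 0 < α) (hα1 : α < 1)
    (s u : ℝ) (hs : 0 < s) (hsu : s < u) (hu : u < 1)
    (hexp : ∀ t ∈ Icc s u, ∀ x : ℝ,
      pfix α u ≤ dist ((x : Circle1)) (0 : Circle1) → 1 < deriv (Flift α t) x)
    (θ : Measure ℝ) (hθprob : IsProbabilityMeasure θ) (hθsupp : θ (Icc s u)ᶜ = 0)
    (P : Measure (ℕ → ℝ)) (hP : IsProductOf θ P) :
    ∀ᵐ p ∂(P.prod (volume : Measure Circle1)),
      pfix α u ≤ dist p.2 (0 : Circle1) →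
        ∃ n : ℕ, 1 ≤ n ∧ dist (fIter α p.1 n p.2) (0 : Circle1) < pfix α u := by
  have hq0 : 0 < pfix α u := pfix_pos α hu
  have hq4 : pfix α u ≤ 1 / 4 := pfix_le hα0 hα1 (hs.trans hsu) hu
  obtain ⟨t₀, ht₀, hmin⟩ := isCompact_Icc.exists_isMinOn (nonempty_Icc.2 hsu.le)
    (f := fun t => leftBranchDeriv α t (pfix α u))
    (by unfold leftBranchDeriv; fun_prop)
  have hl : 1 < leftBranchDeriv α t₀ (pfix α u) := by
    rw [← deriv_Flift α t₀ hq0 (by linarith)]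
    refine hexp t₀ ht₀ _ ?_
    rw [dist_zero_right, norm_coe_circle (by rw [abs_of_pos hq0]; linarith), abs_of_pos hq0]
  have := hP.1
  let B : Set ((ℕ → ℝ) × Circle1) := {p | ∀ k, pfix α u ≤ ‖fIter α p.1 k p.2‖}
  have hB : MeasurableSet B := by
    simp only [B, ofPred_forall]
    exact MeasurableSet.iInter fun k => measurableSet_le measurable_const (measurable_norm_fIter α k)
  have hB0 : (P.prod volume) B = 0 := by
    rw [Measure.measure_prod_null hB]
    filter_upwards [hP.ae_forall_mem measurableSet_Icc hθsupp] with ω hω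
    refine volume_norm_preimage_eq_zero (volume_iInter_survivors hq0 hq4 hl (by positivity)
      (fun k => leftBranch α (ω k)) (fun k => leftBranchDeriv α (ω k)) fun k =>
      isExpandingBranch_leftBranch hα0 hα1 (hs.le.trans (hω k).1) (hω k).2 hu rfl hl.le
        (hmin (hω k))) (measurable_prodMk_left hB) fun x hx => ?_
    exact mem_iInter.2 fun n => norm_mem_survivors hα0 hq0 n ω
      (fun k => ⟨hs.le.trans (hω k).1, by linarith [(hω k).2]⟩) x hx
  refine measure_mono_null (fun p hp => ?_) hB0
  simp only [dist_zero_right, mem_compl_iff, mem_ofPred_eq, Classical.not_imp, not_exists, not_and,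
    not_lt] at hp
  intro k
  rcases Nat.eq_zero_or_pos k with rfl | hk
  · exact hp.1
  · exact hp.2 k hk
end
end

section
/- Let X be a compact metric space, t_0 ∈ X, and let (θ_k)_{k≥1} be a sequence of non-atomic Borel probability measures on X. Then there exists a sequence (ℬ_n)_{n≥1} of finite Borel partitions of Ω = X^ℕ such that: (1) ℬ_{n+1} refines ℬ_n for every n ≥ 1; (2) ω_0 = (t_0, t_0, …) belongs to the topological interior of its atom ℬ_n(ω_0) for every n ≥ 1; (3) for every k ≥ 1 the σ-algebra generated by ⋃_{n≥1} ℬ_n equals the Borel σ-algebra ℬ of Ω modulo θ_k^ℕ-null sets, i.e. for every Borel set B ⊆ Ω there exists a set A in the σ-algebra generated by ⋃_{n≥1} ℬ_n with θ_k^ℕ(A Δ B) = 0. -/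
open MeasureTheory Set Filter Topology

noncomputable section

/-- Every atom of a member partition that contains a point `x` is a neighborhood of `x`, provided
that no set of the sequence accumulates at `x`. -/
theorem memPartition_mem_nhds {Y : Type*} [TopologicalSpace Y] {t : ℕ → Set Y} {x : Y}
    (ht : ∀ n, (t n)ᶜ ∈ 𝓝 x) (n : ℕ) {A : Set Y} (hA : A ∈ memPartition t n) (hx : x ∈ A) :
    A ∈ 𝓝 x := by
  induction n generalizing A with
  | zero =>
    rw [memPartition_zero, Set.mem_singleton_iff] at hA
    exact hA ▸ univ_mem
  | succ n ih =>
    rw [memPartition_succ] at hA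
    obtain ⟨u, hu, rfl | rfl⟩ := hA
    · exact absurd hx.2 (mem_of_mem_nhds (ht n))
    · exact inter_mem (ih hu hx.1) (ht n)

/-- In a first-countable T₁ space with countably generated Borel σ-algebra, for each point `x`
there is a sequence of Borel sets not accumulating at `x` that generates the Borel σ-algebra
up to the point `x`. -/
theorem exists_generating_seq_away_from_point {Y : Type*} [TopologicalSpace Y] [T1Space Y]
    [FirstCountableTopology Y] [MeasurableSpace Y] [OpensMeasurableSpace Y]
    [MeasurableSpace.CountablyGenerated Y] (x : Y) :
    ∃ t : ℕ → Set Y, (∀ n, MeasurableSet (t n)) ∧ (∀ n, (t n)ᶜ ∈ 𝓝 x) ∧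
      ∀ S, MeasurableSet S → ∃ A, MeasurableSet[MeasurableSpace.generateFrom (range t)] A ∧
        symmDiff A S ⊆ {x} := by
  obtain ⟨u, hu⟩ := (𝓝 x).exists_antitone_basis
  let b := MeasurableSpace.natGeneratingSequence Y
  let t : ℕ → Set Y := fun n => b n.unpair.1 \ interior (u n.unpair.2)
  refine ⟨t, fun n => (MeasurableSpace.measurableSet_natGeneratingSequence _).diff
    isOpen_interior.measurableSet, fun n => ?_, ?_⟩
  · filter_upwards [interior_mem_nhds.2 (hu.mem n.unpair.2)] with y hy h
    exact h.2 hy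
  · intro S hS
    rw [← MeasurableSpace.generateFrom_natGeneratingSequence Y] at hS
    induction S, hS using MeasurableSpace.generateFrom_induction with
    | hC S hS _ =>
      obtain ⟨j, rfl⟩ := hS
      refine ⟨⋃ i, t (Nat.pair j i), MeasurableSet.iUnion fun i =>
        MeasurableSpace.measurableSet_generateFrom (mem_range_self _), ?_⟩
      intro y hy
      by_contra hne
      have hxy : ({y}ᶜ : Set Y) ∈ 𝓝 x := isOpen_compl_singleton.mem_nhds (Ne.symm hne)
      obtain ⟨i, hi⟩ := hu.mem_iff.1 hxy
      have hyi : y ∉ interior (u i) := fun h => hi (interior_subset h) rfl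
      rcases hy with ⟨h, h'⟩ | ⟨h, h'⟩
      · obtain ⟨l, hl⟩ := mem_iUnion.1 h
        simp only [t, Nat.unpair_pair] at hl
        exact h' hl.1
      · refine h' (mem_iUnion.2 ⟨i, ?_⟩)
        simp only [t, Nat.unpair_pair]
        exact ⟨h, hyi⟩
    | empty => exact ⟨∅, @MeasurableSet.empty _ (_), by simp⟩
    | compl S _ ih =>
      obtain ⟨A, hA, h⟩ := ih
      exact ⟨Aᶜ, hA.compl, by rwa [compl_symmDiff_compl]⟩
    | iUnion S _ ih =>
      choose A hA h using ih
      refine ⟨⋃ i, A i, MeasurableSet.iUnion hA, ?_⟩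
      rintro y (⟨h1, h2⟩ | ⟨h1, h2⟩)
      · obtain ⟨i, hi⟩ := mem_iUnion.1 h1
        exact h i (Or.inl ⟨hi, fun hs => h2 (mem_iUnion.2 ⟨i, hs⟩)⟩)
      · obtain ⟨i, hi⟩ := mem_iUnion.1 h1
        exact h i (Or.inr ⟨hi, fun hs => h2 (mem_iUnion.2 ⟨i, hs⟩)⟩)

/-- The countable power of a measure vanishes on the points whose first coordinate is not an atom. -/
theorem IsProductOf.measure_singleton_eq_zero {Y : Type*} [MeasurableSpace Y]
    [MeasurableSingletonClass Y] {θ : Measure Y} {P : Measure (ℕ → Y)} (hP : IsProductOf θ P)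
    {ω : ℕ → Y} (hω : θ {ω 0} = 0) : P {ω} = 0 := by
  have h := hP.2 1 (fun _ => {ω 0}) fun _ => measurableSet_singleton _
  simp only [Finset.prod_range_one, hω] at h
  refine measure_mono_null ?_ h
  rintro _ rfl i hi
  rw [Nat.lt_one_iff.1 hi]
  rfl

/-- given a compact metric space `X`, a point `t₀ ∈ X` and a sequence of
non-atomic Borel probability measures `θ_k` on `X`, there is an increasing sequence of
finite Borel partitions `𝓑_n` of `Ω = X^ℕ` such that `ω₀ = (t₀,t₀,…)` lies in the
interior of its atom of each `𝓑_n`, and `⋃_n 𝓑_n` generates the Borel σ-algebra of `Ω`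
modulo `θ_k^ℕ`-null sets, for every `k`. -/
theorem exists_increasing_generating_partitions
    (X : Type*) [MetricSpace X] [CompactSpace X]
    [MeasurableSpace X] [BorelSpace X]
    (t0 : X) (θ : ℕ → Measure X) (hθprob : ∀ k, IsProbabilityMeasure (θ k))
    (hθna : ∀ k (x : X), θ k {x} = 0)
    (P : ℕ → Measure (ℕ → X)) (hP : ∀ k, IsProductOf (θ k) (P k)) :
    ∃ B : ℕ → Finset (Set (ℕ → X)),
      (∀ m, ∀ A ∈ B m, MeasurableSet A) ∧
      (∀ m, ∀ A ∈ B m, ∀ A' ∈ B m, A ≠ A' → Disjoint A A') ∧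
      (∀ m, ⋃₀ (↑(B m) : Set (Set (ℕ → X))) = Set.univ) ∧
      (∀ m, ∀ A ∈ B (m + 1), ∃ A' ∈ B m, A ⊆ A') ∧
      (∀ m, ∀ A ∈ B m, (fun _ : ℕ => t0) ∈ A → (fun _ : ℕ => t0) ∈ interior A) ∧
      (∀ k, ∀ S : Set (ℕ → X), MeasurableSet S →
        ∃ A : Set (ℕ → X),
          MeasurableSet[MeasurableSpace.generateFrom
            (⋃ m, (↑(B m) : Set (Set (ℕ → X))))] A ∧
          P k (symmDiff A S) = 0) := by
  have h0 (k) : P k {fun _ : ℕ => t0} = 0 := (hP k).measure_singleton_eq_zero (hθna k t0)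
  obtain ⟨t, htm, htn, htg⟩ := exists_generating_seq_away_from_point (fun _ : ℕ => t0)
  have hmem (m : ℕ) (A : Set (ℕ → X)) :
      A ∈ (finite_memPartition t m).toFinset ↔ A ∈ memPartition t m := Set.Finite.mem_toFinset _
  refine ⟨fun m => (finite_memPartition t m).toFinset, fun m A hA => ?_, fun m A hA A' hA' hne => ?_,
    fun m => ?_, fun m A hA => ?_, fun m A hA hx => ?_, fun k S hS => ?_⟩
  · exact MeasurableSpace.measurableSet_memPartition htm m ((hmem m A).1 hA)
  · exact disjoint_memPartition t m ((hmem m A).1 hA) ((hmem m A').1 hA') hne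
  · rw [Set.Finite.coe_toFinset, sUnion_memPartition]
  · rw [hmem, memPartition_succ] at hA
    obtain ⟨u, hu, rfl | rfl⟩ := hA
    · exact ⟨u, (hmem m u).2 hu, inter_subset_left⟩
    · exact ⟨u, (hmem m u).2 hu, sdiff_subset⟩
  · exact mem_interior_iff_mem_nhds.2 (memPartition_mem_nhds htn m ((hmem m A).1 hA) hx)
  · obtain ⟨A, hA, hAS⟩ := htg S hS
    refine ⟨A, ?_, measure_mono_null hAS (h0 k)⟩
    have hU : ⋃ m, (↑(finite_memPartition t m).toFinset : Set (Set (ℕ → X))) =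
        ⋃ m, memPartition t m := iUnion_congr fun m => Set.Finite.coe_toFinset _
    rwa [hU, MeasurableSpace.generateFrom_iUnion_memPartition]
end
end
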